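/- Let d ≥ 1 and k ≥ 1, and let A : ZMod (2k+1) → Finset (Fin (d+4)) be pairwise distinct finsets, each of cardinality at least 2, such that A i ∩ A (i+1) = ∅ for all i ∈ ZMod (2k+1), and such that the alternating intersections B i := ⋂_{ℓ=0}^{k-1} A (i + 2ℓ) are nonempty, pairwise disjoint, and satisfy ⋃_{i} B i = Fin (d+4). Then there exists an injective map x : Fin (d+4) → EuclideanSpace ℝ (Fin (d+1)) such that, setting P := convexHull ℝ (Set.range x): (a) affineSpan ℝ (Set.range x) = ⊤; (b) every x i is an extreme point of P; and (c) for every finset S of Fin (d+4) with S ≠ Finset.univ, one has (∀ i ∈ ZMod (2k+1), ¬ A i ⊆ S) if and only if convexHull ℝ (x '' S) is a proper face of P (i.e. IsExtreme ℝ P (convexHull ℝ (x '' S)) and convexHull ℝ (x '' S) ≠ P). In particular, the simplicial complex Σ({A i}) is the boundary complex of a simplicial (d+1)-polytope, hence a simplicial d-sphere. -/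

import Mathlib

/-- The alternating `k`-fold intersection `B i = A i ∩ A (i+2) ∩ ⋯ ∩ A (i+2(k-1))` of a
cyclically indexed family `A : ZMod (2k+1) → Finset (Fin m)`. -/
def altInter {m k : ℕ} (A : ZMod (2 * k + 1) → Finset (Fin m)) (i : ZMod (2 * k + 1)) :
    Finset (Fin m) :=
  (Finset.range k).inf fun ℓ => A (i + 2 * (ℓ : ZMod (2 * k + 1)))

lemma aux_mem {n k : ℕ} (hk : 1 ≤ k) (A : ZMod (2 * k + 1) → Finset (Fin n))
    (hconsec : ∀ i, A i ∩ A (i + 1) = ∅)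
    (hBcover : (Finset.univ.sup fun i : ZMod (2 * k + 1) => altInter A i) = Finset.univ) :
    ∃ σ : Fin n → ℤ, ∀ v i, v ∈ A i ↔ ∃ m : ℤ, 0 ≤ m ∧ m < k ∧
      i = 2 * ((σ v + m : ℤ) : ZMod (2 * k + 1)) := by
  have h2 : (2 : ZMod (2 * k + 1)) * (k + 1) = 1 := by
    have : ((2 * k + 1 : ℕ) : ZMod (2 * k + 1)) = 0 := ZMod.natCast_self _
    push_cast at this
    linear_combination this
  have hcov : ∀ v : Fin n, ∃ j, v ∈ altInter A j := by
    intro v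
    have : v ∈ Finset.univ.sup fun i : ZMod (2 * k + 1) => altInter A i := by
      rw [hBcover]; exact Finset.mem_univ v
    simpa [Finset.mem_sup] using this
  choose t ht using hcov
  have hmem : ∀ v (m : ℕ), m < k → v ∈ A (t v + 2 * (m : ZMod (2 * k + 1))) := by
    intro v m hm
    have := ht v
    unfold altInter at this
    rw [Finset.mem_inf] at this
    exact this m (Finset.mem_range.2 hm)
  have hno : ∀ v i, v ∈ A i → v ∈ A (i + 1) → False := by
    intro v i h1 h2
    have : v ∈ A i ∩ A (i + 1) := Finset.mem_inter.2 ⟨h1, h2⟩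
    rw [hconsec] at this
    simp at this
  have hval : ∀ z : ZMod (2 * k + 1), ((z.val : ℕ) : ZMod (2 * k + 1)) = z := fun z =>
    ZMod.natCast_zmod_val z
  refine ⟨fun v => (((t v) * (k + 1)).val : ℕ), fun v i => ?_⟩
  have hσ : (2 : ZMod (2 * k + 1)) * (((((t v) * (k + 1)).val : ℕ) : ℤ) : ZMod (2 * k + 1)) = t v := by
    rw [Int.cast_natCast, hval]
    linear_combination (t v) * h2
  constructor
  · intro hv
    set r := ((i - t v) * (k + 1)).val with hr
    have hir : i = t v + 2 * (r : ZMod (2 * k + 1)) := by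
      rw [hr, hval]
      linear_combination -(i - t v) * h2
    have hrlt : r < 2 * k + 1 := ZMod.val_lt _
    rcases lt_trichotomy r k with h | h | h
    · refine ⟨r, by positivity, by exact_mod_cast h, ?_⟩
      rw [Int.cast_add, mul_add, hσ, hir]; simp
    · exfalso
      apply hno v i hv
      have h0 := hmem v 0 (by omega)
      have : i + 1 = t v + 2 * ((0 : ℕ) : ZMod (2 * k + 1)) := by
        rw [hir, h]; push_cast; linear_combination h2
      rw [this]; exact h0
    · exfalso
      obtain ⟨m, hm⟩ : ∃ m, r = k + 1 + m := ⟨r - (k + 1), by omega⟩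
      apply hno v _ (hmem v m (by omega))
      have : t v + 2 * (m : ZMod (2 * k + 1)) + 1 = i := by
        rw [hir, hm]; push_cast; linear_combination - h2
      rw [this]; exact hv
  · rintro ⟨m, hm0, hmk, rfl⟩
    obtain ⟨m, rfl⟩ := Int.eq_ofNat_of_zero_le hm0
    have := hmem v m (by exact_mod_cast hmk)
    rw [Int.cast_add, mul_add, hσ]
    simpa using this

noncomputable def aux_th (k : ℕ) : ℝ := 2 * Real.pi / (2 * k + 1)

lemma aux_period {k : ℕ} {s r : ℤ} (h : (s : ZMod (2 * k + 1)) = r) (ψ : ℝ) :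
    Real.sin (aux_th k * s + ψ) = Real.sin (aux_th k * r + ψ) ∧
    Real.cos (aux_th k * s + ψ) = Real.cos (aux_th k * r + ψ) := by
  have h1 := (ZMod.intCast_eq_intCast_iff_dvd_sub r s (2 * k + 1)).1 h.symm
  obtain ⟨z, hz⟩ := h1
  have hs : (s : ℝ) = r + (2 * k + 1) * z := by
    have : s = r + (2 * k + 1) * z := by push_cast at hz; linarith
    rw [this]; push_cast; ring
  have : aux_th k * s + ψ = aux_th k * r + ψ + z * (2 * Real.pi) := by
    rw [hs, aux_th]
    have : (2 * (k : ℝ) + 1) ≠ 0 := by positivity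
    field_simp
    ring
  rw [this]
  exact ⟨Real.sin_add_int_mul_two_pi _ _, Real.cos_add_int_mul_two_pi _ _⟩

lemma aux_sin_pos {k : ℕ} {x : ℝ} (h0 : 0 < x) (h1 : x < k + 1 / 2) : 0 < Real.sin (aux_th k * x) := by
  have hp := Real.pi_pos
  have hk : (0 : ℝ) < 2 * k + 1 := by positivity
  apply Real.sin_pos_of_pos_of_lt_pi
  · unfold aux_th; positivity
  · unfold aux_th
    rw [div_mul_eq_mul_div, div_lt_iff₀ hk]
    nlinarith

lemma aux_pos1 {n k : ℕ} (σ : Fin n → ℤ) (T : Finset (Fin n))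
    (H : ∀ q : ℤ, ∃ v ∈ T, ∃ r : ℤ, q ≤ r ∧ r < q + k ∧ (σ v : ZMod (2 * k + 1)) = r)
    (v0 : Fin n) (hv0 : v0 ∈ T) :
    ∃ l : Fin n → ℝ, (∀ v, 0 ≤ l v) ∧ (∀ v, v ∉ T → l v = 0) ∧ 0 < l v0 ∧
      ∑ v, l v * Real.cos (aux_th k * σ v) = 0 ∧ ∑ v, l v * Real.sin (aux_th k * σ v) = 0 := by
  classical
  set F := (Finset.Icc (1 : ℤ) k).filter
    (fun α => ∃ a ∈ T, (σ a : ZMod (2 * k + 1)) = ((σ v0 + α : ℤ) : ZMod (2 * k + 1))) with hF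
  have hFne : F.Nonempty := by
    obtain ⟨v, hv, r, h1, h2, h3⟩ := H (σ v0 + 1)
    refine ⟨r - σ v0, ?_⟩
    rw [hF, Finset.mem_filter, Finset.mem_Icc]
    refine ⟨⟨by omega, by omega⟩, v, hv, ?_⟩
    rw [h3]; congr 1; ring
  obtain ⟨α, hα, hmax⟩ := F.exists_max_image id hFne
  rw [hF, Finset.mem_filter, Finset.mem_Icc] at hα
  obtain ⟨⟨hα1, hαk⟩, a, haT, ha⟩ := hα
  obtain ⟨b, hbT, r, hr1, hr2, hb⟩ := H (σ v0 + α + 1)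
  obtain ⟨β, rfl⟩ : ∃ β, r = σ v0 + β := ⟨r - σ v0, by ring⟩
  have hβ : (k : ℤ) + 1 ≤ β := by
    by_contra hcon
    have : β ∈ F := by
      rw [hF, Finset.mem_filter, Finset.mem_Icc]
      exact ⟨⟨by omega, by omega⟩, b, hbT, hb⟩
    have := hmax _ this
    simp at this
    omega
  have hca : (α : ℝ) ≤ k := by exact_mod_cast hαk
  have hca1 : (1 : ℝ) ≤ α := by exact_mod_cast hα1
  have hcb : (k : ℝ) + 1 ≤ β := by exact_mod_cast hβ
  have hcb2 : (β : ℝ) ≤ α + k := by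
    have : β ≤ α + k := by omega
    exact_mod_cast this
  have p1 : 0 < Real.sin (aux_th k * ((β : ℝ) - α)) := aux_sin_pos (by linarith) (by linarith)
  have p2 : 0 < Real.sin (aux_th k * (2 * k + 1 - β)) := aux_sin_pos (by linarith) (by linarith)
  have p3 : 0 < Real.sin (aux_th k * α) := aux_sin_pos (by linarith) (by linarith)
  have e2 : Real.sin (aux_th k * (2 * k + 1 - β)) = - Real.sin (aux_th k * β) := by
    have : aux_th k * (2 * k + 1 - β) = 2 * Real.pi - aux_th k * β := by
      unfold aux_th
      have : (2 * (k : ℝ) + 1) ≠ 0 := by positivity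
      field_simp
    rw [this, Real.sin_two_pi_sub]
  have e1 : Real.sin (aux_th k * ((β : ℝ) - α)) = Real.sin (aux_th k * β) * Real.cos (aux_th k * α)
      - Real.cos (aux_th k * β) * Real.sin (aux_th k * α) := by
    rw [mul_sub, Real.sin_sub]
  have qa := aux_period ha 0
  have qb := aux_period hb 0
  simp only [add_zero, Int.cast_add, mul_add] at qa qb
  rw [Real.sin_add, Real.cos_add] at qa qb
  have key : ∀ f : Fin n → ℝ, ∑ v, ((Pi.single v0 (Real.sin (aux_th k * ((β : ℝ) - α))) : Fin n → ℝ) v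
      + (Pi.single a (Real.sin (aux_th k * (2 * k + 1 - β))) : Fin n → ℝ) v
      + (Pi.single b (Real.sin (aux_th k * α)) : Fin n → ℝ) v) * f v
      = Real.sin (aux_th k * ((β : ℝ) - α)) * f v0 + Real.sin (aux_th k * (2 * k + 1 - β)) * f a
        + Real.sin (aux_th k * α) * f b := by
    intro f
    simp [add_mul, Finset.sum_add_distrib, Pi.single_apply]
  have nn : ∀ (w v : Fin n) (c : ℝ), 0 < c → 0 ≤ (Pi.single w c : Fin n → ℝ) v := by
    intro w v c hc
    rw [Pi.single_apply]; split_ifs <;> linarith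
  refine ⟨_, fun v => ?_, fun v hv => ?_, ?_, (key _).trans ?_, (key _).trans ?_⟩
  · have := nn v0 v _ p1
    have := nn a v _ p2
    have := nn b v _ p3
    positivity
  · have h1 : v ≠ v0 := by rintro rfl; exact hv hv0
    have h2 : v ≠ a := by rintro rfl; exact hv haT
    have h3 : v ≠ b := by rintro rfl; exact hv hbT
    simp [Pi.single_apply, h1, h2, h3]
  · have := nn a v0 _ p2
    have := nn b v0 _ p3
    have : (Pi.single v0 (Real.sin (aux_th k * ((β : ℝ) - α))) : Fin n → ℝ) v0 = Real.sin (aux_th k * ((β : ℝ) - α)) := by simp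
    linarith
  · rw [qa.2, qb.2, e1, e2]; ring
  · rw [qa.1, qb.1, e1, e2]; ring

lemma aux_pos {n k : ℕ} (σ : Fin n → ℤ) (T : Finset (Fin n))
    (H : ∀ q : ℤ, ∃ v ∈ T, ∃ r : ℤ, q ≤ r ∧ r < q + k ∧ (σ v : ZMod (2 * k + 1)) = r) :
    ∃ l : Fin n → ℝ, (∀ v ∈ T, 0 < l v) ∧ (∀ v, v ∉ T → l v = 0) ∧
      ∑ v, l v * Real.cos (aux_th k * σ v) = 0 ∧ ∑ v, l v * Real.sin (aux_th k * σ v) = 0 := by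
  classical
  choose! l h1 h2 h3 h4 h5 using aux_pos1 σ T H
  refine ⟨fun v => ∑ w ∈ T, l w v, fun v hv => ?_, fun v hv => ?_, ?_, ?_⟩
  · exact Finset.sum_pos' (fun w hw => h1 w hw v) ⟨v, hv, h3 v hv⟩
  · exact Finset.sum_eq_zero fun w hw => h2 w hw v hv
  · simp only [Finset.sum_mul]
    rw [Finset.sum_comm]
    exact Finset.sum_eq_zero fun w hw => h4 w hw
  · simp only [Finset.sum_mul]
    rw [Finset.sum_comm]
    exact Finset.sum_eq_zero fun w hw => h5 w hw

lemma aux_sep {k : ℕ} (hk : 0 < k) (u s : ℤ) :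
    ((∃ m : ℤ, 0 ≤ m ∧ m < k ∧ (s : ZMod (2 * k + 1)) = ((u - m : ℤ) : ZMod (2 * k + 1))) →
      Real.sin (aux_th k * s - aux_th k * (u + 3 / 4)) < 0) ∧
    ((¬ ∃ m : ℤ, 0 ≤ m ∧ m < k ∧ (s : ZMod (2 * k + 1)) = ((u - m : ℤ) : ZMod (2 * k + 1))) →
      0 < Real.sin (aux_th k * s - aux_th k * (u + 3 / 4))) := by
  constructor
  · rintro ⟨m, hm0, hmk, h⟩
    rw [sub_eq_add_neg, (aux_period h _).1]
    have : aux_th k * ((u - m : ℤ) : ℝ) + -(aux_th k * (u + 3 / 4)) = -(aux_th k * (m + 3 / 4)) := by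
      push_cast; ring
    rw [this, Real.sin_neg]
    have h0 : (0 : ℝ) ≤ m := by exact_mod_cast hm0
    have h1 : (m : ℝ) + 1 ≤ k := by exact_mod_cast hmk
    have := aux_sin_pos (k := k) (x := m + 3 / 4) (by linarith) (by linarith)
    linarith
  · intro hno
    set N : ℤ := 2 * k + 1 with hN
    have hNpos : 0 < N := by omega
    set r := (s - u) % N with hr
    have hr0 : 0 ≤ r := Int.emod_nonneg _ hNpos.ne'
    have hrN : r < N := Int.emod_lt_of_pos _ hNpos
    have hN0 : ((N : ℤ) : ZMod (2 * k + 1)) = 0 := by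
      have : ((2 * k + 1 : ℕ) : ZMod (2 * k + 1)) = 0 := ZMod.natCast_self _
      rw [hN]; push_cast at this ⊢; exact this
    have h : (s : ZMod (2 * k + 1)) = ((u + r : ℤ) : ZMod (2 * k + 1)) := by
      have h1 : s = u + r + N * ((s - u) / N) := by
        have := Int.emod_add_mul_ediv (s - u) N
        rw [← hr] at this; linarith
      conv_lhs => rw [h1]
      rw [Int.cast_add, Int.cast_mul, hN0]; ring
    have hr1 : 1 ≤ r := by
      by_contra hc
      apply hno
      refine ⟨0, le_rfl, by exact_mod_cast hk, ?_⟩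
      rw [h]; congr 1; omega
    have hrk : r ≤ k + 1 := by
      by_contra hc
      apply hno
      refine ⟨N - r, by omega, by omega, ?_⟩
      rw [h]
      push_cast
      linear_combination hN0
    rw [sub_eq_add_neg, (aux_period h _).1]
    have : aux_th k * ((u + r : ℤ) : ℝ) + -(aux_th k * (u + 3 / 4)) = (aux_th k * (r - 3 / 4)) := by
      push_cast; ring
    rw [this]
    have h0 : (1 : ℝ) ≤ r := by exact_mod_cast hr1
    have h1 : (r : ℝ) ≤ k + 1 := by exact_mod_cast hrk
    exact aux_sin_pos (k := k) (by linarith) (by linarith)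

lemma aux_hull {n : ℕ} {E : Type*} [AddCommGroup E] [Module ℝ E] (x : Fin n → E) (y : E) :
    y ∈ convexHull ℝ (Set.range x) ↔
      ∃ w : Fin n → ℝ, (∀ v, 0 ≤ w v) ∧ ∑ v, w v = 1 ∧ ∑ v, w v • x v = y := by
  classical
  constructor
  · intro hy
    let C : Set E := {y | ∃ w : Fin n → ℝ, (∀ v, 0 ≤ w v) ∧ ∑ v, w v = 1 ∧ ∑ v, w v • x v = y}
    have hC : Convex ℝ C := by
      rintro y ⟨w, h1, h2, h3⟩ y' ⟨w', h1', h2', h3'⟩ a b ha hb hab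
      refine ⟨fun v => a * w v + b * w' v, fun v => ?_, ?_, ?_⟩
      · have := h1 v
        have := h1' v
        positivity
      · rw [Finset.sum_add_distrib, ← Finset.mul_sum, ← Finset.mul_sum, h2, h2']; linarith
      · rw [← h3, ← h3']
        simp only [add_smul, mul_smul, Finset.sum_add_distrib, Finset.smul_sum]
    refine convexHull_min ?_ hC hy
    rintro _ ⟨v, rfl⟩
    refine ⟨Pi.single v 1, fun u => ?_, ?_, ?_⟩
    · rw [Pi.single_apply]; split_ifs <;> norm_num
    · simp
    · simp [Pi.single_apply]
  · rintro ⟨w, h1, h2, rfl⟩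
    exact (convex_convexHull ℝ _).sum_mem (fun i _ => h1 i) h2
      (fun i _ => subset_convexHull ℝ _ ⟨i, rfl⟩)

lemma aux_face {n : ℕ} {E : Type*} [NormedAddCommGroup E] [InnerProductSpace ℝ E] (x : Fin n → E)
    (S : Finset (Fin n)) (a : E) (c : ℝ) (h0 : ∀ v ∈ S, inner ℝ a (x v) + c = 0)
    (h1 : ∀ v, v ∉ S → 0 < inner ℝ a (x v) + c) (hS : S ≠ Finset.univ) :
    IsExtreme ℝ (convexHull ℝ (Set.range x)) (convexHull ℝ (x '' ↑S)) ∧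
            convexHull ℝ (x '' ↑S) ≠ convexHull ℝ (Set.range x) := by
  classical
  have hsub : convexHull ℝ (x '' ↑S) ⊆ convexHull ℝ (Set.range x) :=
    convexHull_mono (Set.image_subset_range _ _)
  have hval : ∀ w : Fin n → ℝ, ∑ v, w v = 1 →
      inner ℝ a (∑ v, w v • x v) + c = ∑ v, w v * (inner ℝ a (x v) + c) := by
    intro w hw
    simp only [mul_add, Finset.sum_add_distrib, inner_sum, inner_smul_right, ← Finset.sum_mul, hw, one_mul]
  have hge : ∀ v, 0 ≤ inner ℝ a (x v) + c := by
    intro v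
    by_cases hv : v ∈ S
    · exact (h0 v hv).ge
    · exact (h1 v hv).le
  have hnn : ∀ y ∈ convexHull ℝ (Set.range x), 0 ≤ inner ℝ a y + c := by
    intro y hy
    obtain ⟨w, hw0, hw1, rfl⟩ := (aux_hull x y).1 hy
    rw [hval w hw1]
    exact Finset.sum_nonneg fun v _ => mul_nonneg (hw0 v) (hge v)
  have hz : ∀ y ∈ convexHull ℝ (Set.range x), inner ℝ a y + c = 0 → y ∈ convexHull ℝ (x '' ↑S) := by
    intro y hy hy0
    obtain ⟨w, hw0, hw1, rfl⟩ := (aux_hull x y).1 hy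
    rw [hval w hw1, Finset.sum_eq_zero_iff_of_nonneg
      (fun v _ => mul_nonneg (hw0 v) (hge v))] at hy0
    have hw : ∀ v, v ∉ S → w v = 0 := by
      intro v hv
      have := hy0 v (Finset.mem_univ v)
      exact (mul_eq_zero.1 this).resolve_right (h1 v hv).ne'
    have e1 : ∑ v ∈ S, w v = 1 := by
      rw [← hw1]
      exact Finset.sum_subset (Finset.subset_univ S) fun v _ hv => hw v hv
    have e2 : ∑ v, w v • x v = ∑ v ∈ S, w v • x v := by
      symm
      exact Finset.sum_subset (Finset.subset_univ S) fun v _ hv => by rw [hw v hv, zero_smul]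
    rw [e2]
    exact (convex_convexHull ℝ _).sum_mem (fun i _ => hw0 i) e1
      (fun i hi => subset_convexHull ℝ _ ⟨i, hi, rfl⟩)
  have hz' : ∀ y ∈ convexHull ℝ (x '' ↑S), inner ℝ a y + c = 0 := by
    have hC : Convex ℝ {y : E | inner ℝ a y + c = 0} := by
      intro y hy y' hy' s t hs ht hst
      simp only [Set.mem_setOf_eq, inner_add_right, inner_smul_right] at *
      have : c = s * c + t * c := by rw [← add_mul, hst, one_mul]
      linear_combination s * hy + t * hy' + this
    intro y hy
    refine convexHull_min ?_ hC hy
    rintro _ ⟨v, hv, rfl⟩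
    exact h0 v hv
  refine ⟨⟨hsub, ?_⟩, ?_⟩
  · rintro y hy y' hy' z hzz ⟨s, t, hs, ht, hst, rfl⟩
    apply hz y hy
    have e := hz' _ hzz
    have i1 := hnn y hy
    have i2 := hnn y' hy'
    rw [inner_add_right, inner_smul_right, inner_smul_right] at e
    have : s * (inner ℝ a y + c) + t * (inner ℝ a y' + c) = 0 := by
      have : c = s * c + t * c := by rw [← add_mul, hst, one_mul]
      linear_combination e - this
    have j1 := mul_nonneg hs.le i1
    have j2 := mul_nonneg ht.le i2
    have : s * (inner ℝ a y + c) = 0 := by linarith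
    exact (mul_eq_zero.1 this).resolve_left hs.ne'
  · intro heq
    obtain ⟨v, hv⟩ : ∃ v, v ∉ S := by
      by_contra hc
      push Not at hc
      exact hS (Finset.eq_univ_iff_forall.2 hc)
    have hm : x v ∈ convexHull ℝ (x '' ↑S) := by
      rw [heq]; exact subset_convexHull ℝ _ ⟨v, rfl⟩
    have := hz' _ hm
    have := h1 v hv
    linarith

lemma aux_nonface {n : ℕ} {E : Type*} [AddCommGroup E] [Module ℝ E] (x : Fin n → E)
    (S A : Finset (Fin n)) (hAS : A ⊆ S) (hA : A.Nonempty) (μ : Fin n → ℝ) (hm : ∀ v ∈ A, μ v < 0)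
    (hp : ∀ v, v ∉ A → 0 < μ v) (h1 : ∑ v, μ v = 0) (h2 : ∑ v, μ v • x v = 0)
    (hE : IsExtreme ℝ (convexHull ℝ (Set.range x)) (convexHull ℝ (x '' ↑S))) :
    convexHull ℝ (x '' ↑S) = convexHull ℝ (Set.range x) := by
  classical
  refine hE.subset.antisymm (convexHull_min ?_ (convex_convexHull ℝ _))
  rintro _ ⟨u, rfl⟩
  by_cases hu : u ∈ A
  · exact subset_convexHull ℝ _ ⟨u, hAS hu, rfl⟩
  set N := ∑ v ∈ A, -μ v with hN
  have hNpos : 0 < N := Finset.sum_pos (fun v hv => by linarith [hm v hv]) hA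
  set y := ∑ v ∈ A, (N⁻¹ * -μ v) • x v with hy
  have hyS : y ∈ convexHull ℝ (x '' ↑S) := by
    refine (convex_convexHull ℝ _).sum_mem (fun i hi => ?_) ?_
      (fun i hi => subset_convexHull ℝ _ ⟨i, hAS hi, rfl⟩)
    · have := hm i hi
      exact mul_nonneg (by positivity) (by linarith)
    · rw [← Finset.mul_sum, ← hN]; field_simp
  have hN' : N = ∑ v ∈ Aᶜ, μ v := by
    have := Finset.sum_add_sum_compl A μ
    rw [hN, Finset.sum_neg_distrib]; linarith
  have hy' : y = ∑ v ∈ Aᶜ, (N⁻¹ * μ v) • x v := by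
    have h3 := Finset.sum_add_sum_compl A (fun v => μ v • x v)
    rw [h2] at h3
    simp only [hy, mul_smul, ← Finset.smul_sum, neg_smul, Finset.sum_neg_distrib]
    rw [eq_neg_of_add_eq_zero_left h3, neg_neg]
  have huA : u ∈ Aᶜ := Finset.mem_compl.2 hu
  have hle : μ u ≤ N := by
    rw [hN']
    exact Finset.single_le_sum (f := μ) (fun v hv => (hp v (Finset.mem_compl.1 hv)).le) huA
  have hup := hp u hu
  set t := N⁻¹ * μ u / 2 with ht
  have ht0 : 0 < t := by positivity
  have ht1 : t ≤ 1 / 2 := by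
    have : N⁻¹ * μ u ≤ 1 := by rw [inv_mul_le_iff₀ hNpos]; linarith
    linarith
  set z := ∑ v ∈ Aᶜ, ((1 - t)⁻¹ * (N⁻¹ * μ v - if v = u then t else 0)) • x v with hz
  have hzP : z ∈ convexHull ℝ (Set.range x) := by
    refine (convex_convexHull ℝ _).sum_mem (fun i hi => ?_) ?_
      (fun i hi => subset_convexHull ℝ _ ⟨i, rfl⟩)
    · have hi' := hp i (Finset.mem_compl.1 hi)
      have : 0 < N⁻¹ * μ i := by positivity
      refine mul_nonneg (inv_nonneg.2 (by linarith)) ?_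
      split_ifs with h
      · subst h; linarith
      · linarith
    · rw [← Finset.mul_sum, Finset.sum_sub_distrib, ← Finset.mul_sum, ← hN', Finset.sum_ite_eq' , if_pos huA,
        inv_mul_cancel₀ hNpos.ne', inv_mul_cancel₀ (by linarith)]
  refine hE.left_mem_of_mem_openSegment (subset_convexHull ℝ _ ⟨u, rfl⟩) hzP hyS
    ⟨t, 1 - t, ht0, by linarith, by ring, ?_⟩
  have h1t : (1 - t) ≠ 0 := by linarith
  have : (1 - t) • z = y - t • x u := by
    rw [hz, hy', Finset.smul_sum]
    simp only [smul_smul, mul_inv_cancel_left₀ h1t, sub_smul, Finset.sum_sub_distrib, ite_smul, zero_smul]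
    rw [Finset.sum_ite_eq', if_pos huA]
  rw [this]; abel

lemma aux_gale {d : ℕ} (g h : Fin (d + 4) → ℝ) (hg : ∑ v, g v = 0) (hh : ∑ v, h v = 0)
    (a b : Fin (d + 4)) (hab : g a * h b - h a * g b ≠ 0) :
    ∃ x : Fin (d + 4) → EuclideanSpace ℝ (Fin (d + 1)),
      affineSpan ℝ (Set.range x) = ⊤ ∧
      (∑ v, g v • x v = 0) ∧ (∑ v, h v • x v = 0) ∧
      ∀ l : Fin (d + 4) → ℝ, ∑ v, l v * g v = 0 → ∑ v, l v * h v = 0 →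
        ∃ (y : EuclideanSpace ℝ (Fin (d + 1))) (c : ℝ), ∀ v, l v = inner ℝ y (x v) + c := by
  classical
  let L : (Fin (d + 4) → ℝ) →ₗ[ℝ] (Fin 3 → ℝ) := LinearMap.pi
    ![Fintype.linearCombination ℝ g, Fintype.linearCombination ℝ h,
      Fintype.linearCombination ℝ (fun _ => (1 : ℝ))]
  have L0 : ∀ l, L l 0 = ∑ v, l v * g v := fun l => by
    simp [L, Fintype.linearCombination_apply]
  have L1 : ∀ l, L l 1 = ∑ v, l v * h v := fun l => by
    simp [L, Fintype.linearCombination_apply]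
  have L2 : ∀ l, L l 2 = ∑ v, l v := fun l => by
    simp [L, Fintype.linearCombination_apply]
  have hn : ((d + 4 : ℕ) : ℝ) ≠ 0 := by positivity
  have hsurj : Function.Surjective L := by
    intro w
    set D := g a * h b - h a * g b with hD
    set p := (w 0 * h b - w 1 * g b) / D with hp
    set q := (g a * w 1 - h a * w 0) / D with hq
    set e := (w 2 - p - q) / ((d + 4 : ℕ) : ℝ) with he
    have key : ∀ f : Fin (d + 4) → ℝ, ∑ v, ((Pi.single a p : Fin (d + 4) → ℝ) v
      + (Pi.single b q : Fin (d + 4) → ℝ) v + e) * f v = p * f a + q * f b + e * ∑ v, f v := by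
      intro f
      simp [add_mul, Finset.sum_add_distrib, Pi.single_apply, Finset.mul_sum]
    refine ⟨fun v => (Pi.single a p : Fin (d + 4) → ℝ) v
      + (Pi.single b q : Fin (d + 4) → ℝ) v + e, ?_⟩
    funext i
    fin_cases i
    · refine (L0 _).trans ?_
      rw [key, hg, hp, hq]
      simp only [Fin.zero_eta, mul_zero, add_zero]
      field_simp
      rw [hD]; ring
    · refine (L1 _).trans ?_
      rw [key, hh, hp, hq]
      simp only [Fin.mk_one, mul_zero, add_zero]
      field_simp
      rw [hD]; ring
    · refine (L2 _).trans ?_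
      have := key (fun _ => 1)
      simp only [mul_one] at this
      rw [this]
      simp only [Finset.sum_const, Finset.card_univ, Fintype.card_fin, nsmul_eq_mul, mul_one, he]
      rw [div_mul_cancel₀ _ hn]
      simp
  have hdim : Module.finrank ℝ (LinearMap.ker L) = d + 1 := by
    have := LinearMap.finrank_range_add_finrank_ker L
    rw [LinearMap.range_eq_top.2 hsurj, finrank_top] at this
    simp at this
    omega
  let bs : Module.Basis (Fin (d + 1)) ℝ (LinearMap.ker L) := Module.finBasisOfFinrankEq ℝ _ hdim
  have hk : ∀ i, L (bs i : Fin (d + 4) → ℝ) = 0 := fun i => (bs i).2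
  have k0 : ∀ i, ∑ v, (bs i : Fin (d + 4) → ℝ) v * g v = 0 := fun i => by rw [← L0, hk]; rfl
  have k1 : ∀ i, ∑ v, (bs i : Fin (d + 4) → ℝ) v * h v = 0 := fun i => by rw [← L1, hk]; rfl
  have k2 : ∀ i, ∑ v, (bs i : Fin (d + 4) → ℝ) v = 0 := fun i => by rw [← L2, hk]; rfl
  let x : Fin (d + 4) → EuclideanSpace ℝ (Fin (d + 1)) :=
    fun v => WithLp.toLp 2 (fun i => (bs i : Fin (d + 4) → ℝ) v)
  have hx : ∀ v i, x v i = (bs i : Fin (d + 4) → ℝ) v := fun v i => rfl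
  have hin : ∀ (y : EuclideanSpace ℝ (Fin (d + 1))) v,
      inner ℝ y (x v) = ((∑ i, y i • bs i : LinearMap.ker L) : Fin (d + 4) → ℝ) v := by
    intro y v
    simp [PiLp.inner_apply, hx, mul_comm]
  have hsum0 : ∑ v, x v = 0 := by
    ext i
    simp [hx, k2]
  refine ⟨x, ?_, ?_, ?_, ?_⟩
  · rw [AffineSubspace.affineSpan_eq_top_iff_vectorSpan_eq_top_of_nonempty ℝ _ _ (Set.range_nonempty x),
      ← Submodule.orthogonal_eq_bot_iff, Submodule.eq_bot_iff]
    intro y hy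
    rw [Submodule.mem_orthogonal'] at hy
    have hc : ∀ v, inner ℝ y (x v) = inner ℝ y (x 0) := by
      intro v
      have := hy (x v -ᵥ x 0) (vsub_mem_vectorSpan ℝ ⟨v, rfl⟩ ⟨0, rfl⟩)
      rw [vsub_eq_sub, inner_sub_right] at this
      linarith
    have h0 : inner ℝ y (x 0) = 0 := by
      have : inner ℝ y (∑ v, x v) = ((d + 4 : ℕ) : ℝ) * inner ℝ y (x 0) := by
        rw [inner_sum, Finset.sum_congr rfl fun v _ => hc v]
        simp
      rw [hsum0, inner_zero_right] at this
      exact (mul_eq_zero.1 this.symm).resolve_left hn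
    have hz : (∑ i, y i • bs i : LinearMap.ker L) = 0 := by
      apply Subtype.ext
      funext v
      rw [← hin, hc, h0]; rfl
    have := Fintype.linearIndependent_iff.1 bs.linearIndependent (fun i => y i) hz
    ext i
    exact this i
  · ext i
    have := k0 i
    simpa [hx, mul_comm] using this
  · ext i
    have := k1 i
    simpa [hx, mul_comm] using this
  · intro l h0 h1
    set c := (∑ v, l v) / ((d + 4 : ℕ) : ℝ) with hc
    have hm : (fun v => l v - c) ∈ LinearMap.ker L := by
      rw [LinearMap.mem_ker]
      funext i
      fin_cases i
      · refine (L0 _).trans ?_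
        simp [sub_mul, ← Finset.mul_sum, h0, hg]
      · refine (L1 _).trans ?_
        simp [sub_mul, ← Finset.mul_sum, h1, hh]
      · refine (L2 _).trans ?_
        rw [Finset.sum_sub_distrib, Finset.sum_const, Finset.card_univ, Fintype.card_fin, nsmul_eq_mul, hc,
          mul_div_cancel₀ _ hn]
        simp
    refine ⟨WithLp.toLp 2 (fun i => bs.repr ⟨_, hm⟩ i), c, fun v => ?_⟩
    rw [hin]
    have := bs.sum_repr ⟨_, hm⟩
    simp only
    rw [this]
    ring

theorem stmt12 {d k : ℕ} (hd : 1 ≤ d) (hk : 1 ≤ k)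
    (A : ZMod (2 * k + 1) → Finset (Fin (d + 4)))
    (hAinj : Function.Injective A)
    (hcard : ∀ i, 2 ≤ (A i).card)
    (hconsec : ∀ i, A i ∩ A (i + 1) = ∅)
    (hBne : ∀ i, (altInter A i).Nonempty)
    (hBdisj : ∀ i j, i ≠ j → altInter A i ∩ altInter A j = ∅)
    (hBcover : (Finset.univ.sup fun i : ZMod (2 * k + 1) => altInter A i) = Finset.univ) :
    ∃ x : Fin (d + 4) → EuclideanSpace ℝ (Fin (d + 1)),
      Function.Injective x ∧
      affineSpan ℝ (Set.range x) = ⊤ ∧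
      (∀ i, x i ∈ Set.extremePoints ℝ (convexHull ℝ (Set.range x))) ∧
      ∀ S : Finset (Fin (d + 4)), S ≠ Finset.univ →
        ((∀ i : ZMod (2 * k + 1), ¬ A i ⊆ S) ↔
          (IsExtreme ℝ (convexHull ℝ (Set.range x)) (convexHull ℝ (x '' ↑S)) ∧
            convexHull ℝ (x '' ↑S) ≠ convexHull ℝ (Set.range x))) := by
  classical
  obtain ⟨σ, hσ⟩ := aux_mem hk A hconsec hBcover
  have h2 : (2 : ZMod (2 * k + 1)) * (k + 1) = 1 := by
    have : ((2 * k + 1 : ℕ) : ZMod (2 * k + 1)) = 0 := ZMod.natCast_self _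
    push_cast at this
    linear_combination this
  have hcancel : ∀ p q : ZMod (2 * k + 1), 2 * p = 2 * q → p = q := by
    intro p q h
    linear_combination (k + 1) * h - (p - q) * h2
  -- membership in terms of integer representatives
  have hσ' : ∀ v (u : ℤ), v ∈ A (2 * (u : ZMod (2 * k + 1))) ↔
      ∃ m : ℤ, 0 ≤ m ∧ m < k ∧ (σ v : ZMod (2 * k + 1)) = ((u - m : ℤ) : ZMod (2 * k + 1)) := by
    intro v u
    rw [hσ]
    refine exists_congr fun m => and_congr_right fun _ => and_congr_right fun _ => ?_
    constructor
    · intro h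
      have := hcancel _ _ h
      push_cast at this ⊢
      linear_combination -this
    · intro h
      push_cast at h ⊢
      linear_combination -2 * h
  have hAne : ∀ i, (A i).Nonempty := fun i => Finset.card_pos.1 (by have := hcard i; omega)
  have hpos : ∀ T : Finset (Fin (d + 4)), (∀ i, ∃ v ∈ T, v ∈ A i) →
      ∃ l : Fin (d + 4) → ℝ, (∀ v ∈ T, 0 < l v) ∧ (∀ v, v ∉ T → l v = 0) ∧
      ∑ v, l v * Real.cos (aux_th k * σ v) = 0 ∧ ∑ v, l v * Real.sin (aux_th k * σ v) = 0 := by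
    intro T hT
    apply aux_pos
    intro q
    obtain ⟨v, hvT, hv⟩ := hT (2 * ((q + k - 1 : ℤ) : ZMod (2 * k + 1)))
    obtain ⟨m, hm0, hmk, h⟩ := (hσ' _ _).1 hv
    exact ⟨v, hvT, _, by omega, by omega, h⟩
  obtain ⟨c, hc0, -, hcc, hcs⟩ := hpos Finset.univ (fun i => by
    obtain ⟨v, hv⟩ := hAne i
    exact ⟨v, Finset.mem_univ v, hv⟩)
  replace hc0 : ∀ v, 0 < c v := fun v => hc0 v (Finset.mem_univ v)
  -- two points in neighbouring groups
  have hex : ∀ u : ℤ, ∃ v, (σ v : ZMod (2 * k + 1)) = u := by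
    intro u
    obtain ⟨v, hv⟩ := hBne (2 * (u : ZMod (2 * k + 1)))
    unfold altInter at hv
    rw [Finset.mem_inf] at hv
    have hA1 : v ∈ A (2 * (u : ZMod (2 * k + 1))) := by
      simpa using hv 0 (Finset.mem_range.2 hk)
    have hA2 : v ∈ A (2 * ((u + k - 1 : ℤ) : ZMod (2 * k + 1))) := by
      have := hv (k - 1) (Finset.mem_range.2 (by omega))
      convert this using 2
      push_cast [Nat.cast_sub hk]
      ring
    obtain ⟨m, hm0, hmk, h⟩ := (hσ' _ _).1 hA1
    obtain ⟨m', hm0', hmk', h'⟩ := (hσ' _ _).1 hA2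
    rw [h] at h'
    have hd := (ZMod.intCast_eq_intCast_iff_dvd_sub _ _ (2 * k + 1)).1 h'
    have h3 : m = 0 := by
      obtain ⟨z, hz⟩ := hd
      push_cast at hz
      have hz0 : z = 0 := by
        have : z < 1 := by nlinarith
        have : -1 < z := by nlinarith
        omega
      subst hz0
      omega
    refine ⟨v, ?_⟩
    rw [h, h3, sub_zero]
  obtain ⟨a, ha⟩ := hex 0
  obtain ⟨b, hb⟩ := hex 1
  have hdet : (c a * Real.cos (aux_th k * σ a)) * (c b * Real.sin (aux_th k * σ b)) -
      (c a * Real.sin (aux_th k * σ a)) * (c b * Real.cos (aux_th k * σ b)) ≠ 0 := by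
    have qa := aux_period ha 0
    have qb := aux_period hb 0
    simp only [add_zero, Int.cast_zero, mul_zero, Int.cast_one, mul_one, Real.sin_zero, Real.cos_zero] at qa qb
    rw [qa.1, qa.2, qb.1]
    have hk' : (1 : ℝ) ≤ k := by exact_mod_cast hk
    have := aux_sin_pos (k := k) (x := 1) one_pos (by linarith)
    rw [mul_one] at this
    have h1 := hc0 a
    have h2 := hc0 b
    have : 0 < c a * 1 * (c b * Real.sin (aux_th k)) := by positivity
    simp only [mul_zero, zero_mul, sub_zero]
    exact this.ne'
  obtain ⟨x, hx1, hx2, hx3, hx4⟩ := aux_gale (fun v => c v * Real.cos (aux_th k * σ v))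
    (fun v => c v * Real.sin (aux_th k * σ v)) hcc hcs a b hdet
  have hface : ∀ S : Finset (Fin (d + 4)), (∀ i, ¬ A i ⊆ S) →
      ∃ (y : EuclideanSpace ℝ (Fin (d + 1))) (e : ℝ), (∀ v ∈ S, inner ℝ y (x v) + e = 0) ∧
        (∀ v, v ∉ S → 0 < inner ℝ y (x v) + e) := by
    intro S hS
    obtain ⟨l, hl1, hl2, hl3, hl4⟩ := hpos Sᶜ (fun i => by
      obtain ⟨v, hv, hvS⟩ := Finset.not_subset.1 (hS i)
      exact ⟨v, Finset.mem_compl.2 hvS, hv⟩)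
    have hcancel : ∀ v r, l v / c v * (c v * r) = l v * r := by
      intro v r
      have := (hc0 v).ne'
      field_simp
    obtain ⟨y, e, hye⟩ := hx4 (fun v => l v / c v) (by simpa only [hcancel] using hl3)
      (by simpa only [hcancel] using hl4)
    refine ⟨y, e, fun v hv => ?_, fun v hv => ?_⟩
    · rw [← hye, hl2 v (by simpa using hv), zero_div]
    · rw [← hye]
      exact div_pos (hl1 v (Finset.mem_compl.2 hv)) (hc0 v)
  have hsing : ∀ v i, ¬ A i ⊆ {v} := by
    intro v i h
    have := Finset.card_le_card h
    have := hcard i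
    simp at *
    omega
  refine ⟨x, ?_, hx1, ?_, ?_⟩
  · intro v w hvw
    by_contra hne
    obtain ⟨y, e, h1, h2⟩ := hface {v} (hsing v)
    have h3 := h1 v (Finset.mem_singleton_self v)
    have h4 := h2 w (by simpa using fun h => hne h.symm)
    rw [hvw] at h3
    linarith
  · intro v
    obtain ⟨y, e, h1, h2⟩ := hface {v} (hsing v)
    have := (aux_face x {v} y e h1 h2 (by
      intro h
      have := congrArg Finset.card h
      simp at this)).1
    simpa using this
  · intro S hS
    constructor
    · intro h
      obtain ⟨y, e, h1, h2⟩ := hface S h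
      exact aux_face x S y e h1 h2 hS
    · rintro ⟨hE, hne⟩ i hi
      apply hne
      obtain ⟨u, rfl⟩ : ∃ u : ℤ, i = 2 * (u : ZMod (2 * k + 1)) := by
        refine ⟨((i * (k + 1)).val : ℕ), ?_⟩
        rw [Int.cast_natCast, ZMod.natCast_zmod_val]
        linear_combination -i * h2
      set ψ := aux_th k * (u + 3 / 4) with hψ
      have hμ : ∀ v, c v * Real.sin (aux_th k * σ v - ψ) =
          Real.cos ψ * (c v * Real.sin (aux_th k * σ v)) - Real.sin ψ * (c v * Real.cos (aux_th k * σ v)) := by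
        intro v
        rw [Real.sin_sub]; ring
      refine aux_nonface x S _ hi (hAne _) (fun v => c v * Real.sin (aux_th k * σ v - ψ)) ?_ ?_ ?_ ?_ hE
      · intro v hv
        exact mul_neg_of_pos_of_neg (hc0 v) ((aux_sep hk u (σ v)).1 ((hσ' _ _).1 hv))
      · intro v hv
        exact mul_pos (hc0 v) ((aux_sep hk u (σ v)).2 (fun h => hv ((hσ' _ _).2 h)))
      · simp only [hμ]
        rw [Finset.sum_sub_distrib, ← Finset.mul_sum, ← Finset.mul_sum, hcc, hcs]
        simp
      · simp only [hμ, sub_smul]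
        rw [Finset.sum_sub_distrib]
        simp only [mul_smul (Real.cos ψ), mul_smul (Real.sin ψ)]
        rw [← Finset.smul_sum, ← Finset.smul_sum, hx2, hx3]
        simp
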